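/- For all k ∈ ℕ and D ≥ 0 the following alphabet bounds hold: ℛ*_k(D) ⊆ ℛ*_{|𝒮|+2}(D), ℛ‡_k(D) ⊆ ℛ‡_{|𝒮|(|𝒮|+6)|𝒮̂|^{|𝒰|}+4}(D), and ℛ†_k(D) ⊆ ℛ†_{|𝒮|(|𝒮|+4)|𝒮̂|^{|𝒰|}+1}(D). Consequently the unions ℛ*(D) = ∪_k ℛ*_k(D), ℛ‡(D) = ∪_k ℛ‡_k(D), ℛ†(D) = ∪_k ℛ†_k(D) satisfy ℛ*(D) = ℛ*_{|𝒮|+2}(D), ℛ‡(D) = ℛ‡_{|𝒮|(|𝒮|+6)|𝒮̂|^{|𝒰|}+4}(D), and ℛ†(D) = ℛ†_{|𝒮|(|𝒮|+4)|𝒮̂|^{|𝒰|}+1}(D). -/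

import Mathlib

open Finset

namespace CRR

open scoped Classical

variable {Ω α β γ : Type*}

/-- A probability mass function on a finite type, given as a function. -/
def IsPMF [Fintype Ω] (p : Ω → ℝ) : Prop := (∀ ω, 0 ≤ p ω) ∧ ∑ ω, p ω = 1

/-- Pushforward pmf: the pmf of the random variable `X` when the outcome is drawn from `p`. -/
noncomputable def push [Fintype Ω] (p : Ω → ℝ) (X : Ω → α) (a : α) : ℝ :=
  ∑ ω, if X ω = a then p ω else 0

/-- Shannon entropy (base 2) of a pmf, with the convention 0·log 0 = 0. -/
noncomputable def ent [Fintype α] (q : α → ℝ) : ℝ := -∑ a, q a * Real.logb 2 (q a)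

/-- Entropy of a random variable `X` under `p`. -/
noncomputable def entRV [Fintype Ω] [Fintype α] (p : Ω → ℝ) (X : Ω → α) : ℝ := ent (push p X)

/-- Conditional entropy H(X|Y) under `p`. -/
noncomputable def condEntRV [Fintype Ω] [Fintype α] [Fintype β] (p : Ω → ℝ)
    (X : Ω → α) (Y : Ω → β) : ℝ :=
  entRV p (fun ω => (X ω, Y ω)) - entRV p Y

/-- Conditional mutual information I(X;Y|Z) under `p`. -/
noncomputable def condMI [Fintype Ω] [Fintype α] [Fintype β] [Fintype γ] (p : Ω → ℝ)
    (X : Ω → α) (Y : Ω → β) (Z : Ω → γ) : ℝ :=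
  entRV p (fun ω => (X ω, Z ω)) + entRV p (fun ω => (Y ω, Z ω)) -
    entRV p (fun ω => (X ω, Y ω, Z ω)) - entRV p Z

/-- Markov chain X – Y – Z : X and Z are conditionally independent given Y, under `p`. -/
def MarkovChain [Fintype Ω] (p : Ω → ℝ) (X : Ω → α) (Y : Ω → β) (Z : Ω → γ) : Prop :=
  ∀ x y z, push p (fun ω => (X ω, Y ω, Z ω)) (x, y, z) * push p Y y =
    push p (fun ω => (X ω, Y ω)) (x, y) * push p (fun ω => (Z ω, Y ω)) (z, y)

/-- One step between right nodes of the bipartite graph G^{X,Y}: they share a left neighbour. -/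
def GKStep (p : α × β → ℝ) (y₁ y₂ : β) : Prop := ∃ x, 0 < p (x, y₁) ∧ 0 < p (x, y₂)

/-- y₁ ⇌ y₂ : y₁ and y₂ lie in the same connected component of G^{X,Y}. -/
def GKConn (p : α × β → ℝ) : β → β → Prop := Relation.ReflTransGen (GKStep p)

/-- `g` is a Gács–Körner mapping for the joint pmf `p`. -/
def IsGKMap (p : α × β → ℝ) (g : β → β) : Prop := ∀ y₁ y₂, (g y₁ = g y₂ ↔ GKConn p y₁ y₂)

/-- Expectation of `f` under pmf `p`. -/
noncomputable def expVal [Fintype Ω] (p : Ω → ℝ) (f : Ω → ℝ) : ℝ := ∑ ω, p ω * f ω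

section RateRegions

variable {S U V W : Type*} [Fintype S] [Fintype U] [Fintype V] [Fintype W]

/-- The class 𝒫*_{D,k}: joint pmfs q on (Fin k) × S × U × V (auxiliary alphabet of size k)
with the required marginal, Markov chain A – S – (U,V), and a reconstruction function of the
Gács–Körner common randomness GK^{AU,AV} meeting distortion D. -/
def PStar (p : S × U × V → ℝ) (d : S → W → ℝ) (D : ℝ) (k : ℕ)
    (q : Fin k × S × U × V → ℝ) : Prop :=
  IsPMF q ∧ (∀ y, push q (fun x => x.2) y = p y) ∧
    MarkovChain q (fun x => x.1) (fun x => x.2.1) (fun x => x.2.2) ∧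
    ∃ (g : Fin k × V → Fin k × V) (f : Fin k × V → W),
      IsGKMap (push q (fun x => ((x.1, x.2.2.1), (x.1, x.2.2.2)))) g ∧
      expVal q (fun x => d x.2.1 (f (g (x.1, x.2.2.2)))) ≤ D

/-- The rate region ℛ*_k(D). -/
def RStar (p : S × U × V → ℝ) (d : S → W → ℝ) (D : ℝ) (k : ℕ) : Set (ℝ × ℝ) :=
  {r : ℝ × ℝ | 0 ≤ r.1 ∧ 0 ≤ r.2 ∧ ∃ q : Fin k × S × U × V → ℝ, PStar p d D k q ∧
    condMI q (fun x => x.2.1) (fun x => x.1) (fun x => x.2.2.1) ≤ r.1 ∧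
    condMI q (fun x => x.2.1) (fun x => x.1) (fun x => x.2.2.2) ≤ r.2 + r.1}

/-- The class 𝒫‡_{D,k}: joint pmfs q on (Fin k × Fin k × Fin k) × S × U × V
(coordinates (A,B,C,S,U,V)) with marginal p, Markov chain (A,B,C) – S – (U,V) and a
reconstruction function of GK^{ABU,ACV} meeting distortion D. -/
def PDdag (p : S × U × V → ℝ) (d : S → W → ℝ) (D : ℝ) (k : ℕ)
    (q : (Fin k × Fin k × Fin k) × S × U × V → ℝ) : Prop :=
  IsPMF q ∧ (∀ y, push q (fun x => x.2) y = p y) ∧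
    MarkovChain q (fun x => x.1) (fun x => x.2.1) (fun x => x.2.2) ∧
    ∃ (g : Fin k × Fin k × V → Fin k × Fin k × V) (f : Fin k × Fin k × V → W),
      IsGKMap (push q (fun x => ((x.1.1, x.1.2.1, x.2.2.1), (x.1.1, x.1.2.2, x.2.2.2)))) g ∧
      expVal q (fun x => d x.2.1 (f (g (x.1.1, x.1.2.2, x.2.2.2)))) ≤ D

/-- The rate region ℛ‡_k(D). -/
def RDdag (p : S × U × V → ℝ) (d : S → W → ℝ) (D : ℝ) (k : ℕ) : Set (ℝ × ℝ) :=
  {r : ℝ × ℝ | 0 ≤ r.1 ∧ 0 ≤ r.2 ∧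
    ∃ q : (Fin k × Fin k × Fin k) × S × U × V → ℝ, PDdag p d D k q ∧
    condMI q (fun x => x.2.1) (fun x => (x.1.1, x.1.2.1)) (fun x => x.2.2.1) ≤ r.1 ∧
    condMI q (fun x => x.2.1) (fun x => x.1.2.1) (fun x => (x.1.1, x.1.2.2, x.2.2)) +
      condMI q (fun x => x.2.1) (fun x => (x.1.1, x.1.2.2)) (fun x => x.2.2.2) ≤ r.2 + r.1}

/-- The class 𝒫†_{D,k}: members of 𝒫‡_{D,k} with additionally B – (A,S) – C. -/
def PDag (p : S × U × V → ℝ) (d : S → W → ℝ) (D : ℝ) (k : ℕ)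
    (q : (Fin k × Fin k × Fin k) × S × U × V → ℝ) : Prop :=
  PDdag p d D k q ∧
    MarkovChain q (fun x => x.1.2.1) (fun x => (x.1.1, x.2.1)) (fun x => x.1.2.2)

/-- The rate region ℛ†_k(D). -/
def RDag (p : S × U × V → ℝ) (d : S → W → ℝ) (D : ℝ) (k : ℕ) : Set (ℝ × ℝ) :=
  {r : ℝ × ℝ | 0 ≤ r.1 ∧ 0 ≤ r.2 ∧
    ∃ q : (Fin k × Fin k × Fin k) × S × U × V → ℝ, PDag p d D k q ∧
    condMI q (fun x => x.2.1) (fun x => (x.1.1, x.1.2.1)) (fun x => x.2.2.1) ≤ r.1 ∧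
    max (condMI q (fun x => x.2.1) (fun x => x.1.1) (fun x => x.2.2.1))
        (condMI q (fun x => x.2.1) (fun x => x.1.1) (fun x => x.2.2.2)) +
      condMI q (fun x => x.2.1) (fun x => x.1.2.1) (fun x => (x.1.1, x.2.2.1)) +
      condMI q (fun x => x.2.1) (fun x => x.1.2.2) (fun x => (x.1.1, x.2.2.2)) ≤ r.2 + r.1}

end RateRegions

section Reduction

/-- A nonnegative weight vector can be replaced by one supported on at most as many points as
there are linear constraints, keeping every constraint and not increasing a linear cost. -/
theorem exists_sparse_weights {ι J : Type*} [Fintype ι] [Fintype J] (M : J → ι → ℝ)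
    (c : ι → ℝ) (l : J → ℝ) :
    ∀ (n : ℕ) (w : ι → ℝ), (∀ i, 0 ≤ w i) → (∀ i, w i ≠ 0 → 0 < ∑ j, l j * M j i) →
      #{i | w i ≠ 0} ≤ n →
      ∃ w' : ι → ℝ, (∀ i, 0 ≤ w' i) ∧ #{i | w' i ≠ 0} ≤ Fintype.card J ∧
        (∀ j, ∑ i, w' i * M j i = ∑ i, w i * M j i) ∧ ∑ i, w' i * c i ≤ ∑ i, w i * c i := by
  intro n
  induction n with
  | zero =>
    intro w hw _ hn
    exact ⟨w, hw, hn.trans (Nat.zero_le _), fun _ => rfl, le_rfl⟩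
  | succ n ih =>
    intro w hw hpos hn
    by_cases hcard : #{i | w i ≠ 0} ≤ Fintype.card J
    · exact ⟨w, hw, hcard, fun _ => rfl, le_rfl⟩
    obtain ⟨v, hv0, hvs, hvM, hvc⟩ : ∃ v : ι → ℝ, v ≠ 0 ∧ (∀ i, w i = 0 → v i = 0) ∧
        (∀ j, ∑ i, v i * M j i = 0) ∧ ∑ i, v i * c i ≤ 0 := by
      let T : ({i // w i ≠ 0} → ℝ) →ₗ[ℝ] (J → ℝ) :=
        Matrix.mulVecLin (Matrix.of fun j (i : {i // w i ≠ 0}) => M j i)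
      have hker : LinearMap.ker T ≠ ⊥ := by
        apply LinearMap.ker_ne_bot_of_finrank_lt
        rw [Module.finrank_fintype_fun_eq_card, Module.finrank_fintype_fun_eq_card,
          Fintype.card_subtype]
        omega
      obtain ⟨x, hx, hx0⟩ := (Submodule.ne_bot_iff _).1 hker
      let v : ι → ℝ := fun i => if h : w i ≠ 0 then x ⟨i, h⟩ else 0
      have hsum : ∀ f : ι → ℝ, ∑ i, v i * f i = ∑ i : {i // w i ≠ 0}, x i * f i := by
        intro f
        have h1 : ∑ i, v i * f i = ∑ i with w i ≠ 0, v i * f i := by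
          rw [Finset.sum_filter]
          refine Finset.sum_congr rfl fun i _ => ?_
          by_cases h : w i = 0 <;> simp [v, h]
        rw [h1, Finset.sum_subtype (p := fun i => w i ≠ 0) _ (by simp)]
        refine Finset.sum_congr rfl fun i _ => ?_
        simp [v, i.2]
      have hvM : ∀ j, ∑ i, v i * M j i = 0 := by
        intro j
        rw [hsum]
        have := congrFun (LinearMap.mem_ker.1 hx) j
        simpa [T, Matrix.mulVec, dotProduct, mul_comm] using this
      have hv0 : v ≠ 0 := by
        intro h
        apply hx0
        ext i
        have := congrFun h i
        simpa [v, i.2] using this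
      have hvs : ∀ i, w i = 0 → v i = 0 := fun i hi => by simp [v, hi]
      rcases le_total (∑ i, v i * c i) 0 with h | h
      · exact ⟨v, hv0, hvs, hvM, h⟩
      · refine ⟨-v, neg_ne_zero.2 hv0, fun i hi => by simp [hvs i hi], fun j => ?_, ?_⟩
        · simp [hvM j]
        · simpa using h
    have hmass : ∑ i, v i * ∑ j, l j * M j i = 0 := by
      simp_rw [Finset.mul_sum]
      rw [Finset.sum_comm]
      refine Finset.sum_eq_zero fun j _ => ?_
      have := hvM j
      calc ∑ i, v i * (l j * M j i) = l j * ∑ i, v i * M j i := by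
            rw [Finset.mul_sum]; exact Finset.sum_congr rfl fun i _ => by ring
        _ = 0 := by rw [this, mul_zero]
    have hneg : ∃ i, v i < 0 := by
      by_contra! hnn
      apply hv0
      have hz := (Finset.sum_eq_zero_iff_of_nonneg (fun i _ => ?_)).1 hmass
      · ext i
        by_contra hne
        have hwi : w i ≠ 0 := fun h => hne (hvs i h)
        have := hz i (Finset.mem_univ i)
        rcases mul_eq_zero.1 this with h | h
        · exact hne h
        · exact (hpos i hwi).ne' h
      · by_cases hwi : w i = 0
        · simp [hvs i hwi]
        · exact mul_nonneg (hnn i) (hpos i hwi).le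
    obtain ⟨i₀, hi₀, hmin⟩ := Finset.exists_min_image {i | v i < 0} (fun i => w i / -v i)
      (by obtain ⟨i, hi⟩ := hneg; exact ⟨i, by simpa using hi⟩)
    replace hi₀ : v i₀ < 0 := by simpa using hi₀
    set t := w i₀ / -v i₀ with ht
    have ht0 : 0 ≤ t := div_nonneg (hw i₀) (by linarith)
    have hzero : w i₀ + t * v i₀ = 0 := by
      have := hi₀.ne
      rw [ht]; field_simp; ring
    have hwi₀ : w i₀ ≠ 0 := fun h => hi₀.ne (hvs i₀ h)
    have hsub : ∀ i, w i + t * v i ≠ 0 → w i ≠ 0 := by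
      intro i hi h
      exact hi (by rw [h, hvs i h]; ring)
    have hnonneg : ∀ i, 0 ≤ w i + t * v i := by
      intro i
      rcases lt_or_ge (v i) 0 with h | h
      · have := hmin i (by simpa using h)
        rw [le_div_iff₀ (by linarith)] at this
        linarith
      · exact add_nonneg (hw i) (mul_nonneg ht0 h)
    have hlt : #{i | w i + t * v i ≠ 0} ≤ n := by
      refine Nat.le_of_lt_succ (lt_of_lt_of_le (Finset.card_lt_card ?_) hn)
      refine (Finset.ssubset_iff_of_subset fun i hi => ?_).2 ⟨i₀, by simpa using hwi₀, ?_⟩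
      · simpa using hsub i (by simpa using hi)
      · simpa using hzero
    obtain ⟨w', h1, h2, h3, h4⟩ := ih (fun i => w i + t * v i) hnonneg
      (fun i hi => hpos i (hsub i hi)) hlt
    refine ⟨w', h1, h2, fun j => ?_, h4.trans ?_⟩
    · rw [h3 j]
      simp only [add_mul, Finset.sum_add_distrib, mul_assoc, ← Finset.mul_sum, hvM j]
      ring
    · simp only [add_mul, Finset.sum_add_distrib, mul_assoc, ← Finset.mul_sum]
      nlinarith

end Reduction

section Pushforward

variable [Fintype Ω]

theorem sum_push_mul [Fintype α] (q : Ω → ℝ) (X : Ω → α) (f : α → ℝ) :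
    ∑ a, push q X a * f a = ∑ ω, q ω * f (X ω) := by
  simp only [push, Finset.sum_mul]
  rw [Finset.sum_comm]
  refine Finset.sum_congr rfl fun ω _ => ?_
  simp [ite_mul]

theorem push_eq_sum_mul (q : Ω → ℝ) (X : Ω → α) (a : α) :
    push q X a = ∑ ω, q ω * if X ω = a then 1 else 0 := by
  simp [push]

theorem push_push [Fintype α] (q : Ω → ℝ) (Φ : Ω → α) (X : α → β) :
    push (push q Φ) X = push q (fun ω => X (Φ ω)) := by
  ext b
  rw [push_eq_sum_mul, sum_push_mul q Φ (fun a => if X a = b then 1 else 0), push_eq_sum_mul]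

theorem expVal_push [Fintype α] (q : Ω → ℝ) (Φ : Ω → α) (f : α → ℝ) :
    expVal (push q Φ) f = expVal q (fun ω => f (Φ ω)) :=
  sum_push_mul q Φ f

theorem push_nonneg {q : Ω → ℝ} (hq : ∀ ω, 0 ≤ q ω) (X : Ω → α) (a : α) : 0 ≤ push q X a :=
  Finset.sum_nonneg fun ω _ => by split_ifs <;> simp [hq ω]

theorem le_push {q : Ω → ℝ} (hq : ∀ ω, 0 ≤ q ω) (X : Ω → α) (ω : Ω) : q ω ≤ push q X (X ω) := by
  have := Finset.single_le_sum (f := fun ω' => if X ω' = X ω then q ω' else 0)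
    (fun ω' _ => by split_ifs <;> simp [hq ω']) (Finset.mem_univ ω)
  simpa [push] using this

theorem push_pos {q : Ω → ℝ} (hq : ∀ ω, 0 ≤ q ω) (X : Ω → α) {ω : Ω} (h : q ω ≠ 0) :
    0 < push q X (X ω) :=
  lt_of_lt_of_le (lt_of_le_of_ne (hq ω) h.symm) (le_push hq X ω)

theorem exists_of_push_ne_zero {q : Ω → ℝ} {X : Ω → α} {a : α} (h : push q X a ≠ 0) :
    ∃ ω, X ω = a ∧ q ω ≠ 0 := by
  obtain ⟨ω, -, hω⟩ := Finset.exists_ne_zero_of_sum_ne_zero h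
  refine ⟨ω, ?_⟩
  by_contra hc
  apply hω
  split_ifs with h1
  · by_contra h2
    exact hc ⟨h1, h2⟩
  · rfl

theorem push_congr {q : Ω → ℝ} {X : Ω → α} {Y : Ω → β} {a : α} {b : β}
    (h : ∀ ω, q ω ≠ 0 → (X ω = a ↔ Y ω = b)) : push q X a = push q Y b := by
  refine Finset.sum_congr rfl fun ω _ => ?_
  by_cases hω : q ω = 0
  · simp [hω]
  · simp only [h ω hω]

theorem sum_push [Fintype α] (q : Ω → ℝ) (X : Ω → α) : ∑ a, push q X a = ∑ ω, q ω := by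
  simpa using sum_push_mul q X (fun _ => 1)

theorem sum_push_prod [Fintype α] (q : Ω → ℝ) (X : Ω → α) (Y : Ω → β) (b : β) :
    ∑ a, push q (fun ω => (X ω, Y ω)) (a, b) = push q Y b := by
  simp only [push]
  rw [Finset.sum_comm]
  refine Finset.sum_congr rfl fun ω _ => ?_
  by_cases h : Y ω = b <;> simp [h]

end Pushforward

section Entropy

/-- Two random variables induce the same partition of the support of `q`. -/
def SameKer (q : Ω → ℝ) (X : Ω → α) (Y : Ω → β) : Prop :=
  ∀ ω ω', q ω ≠ 0 → q ω' ≠ 0 → (X ω = X ω' ↔ Y ω = Y ω')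

theorem SameKer.prod {α' β' : Type*} {q : Ω → ℝ} {X : Ω → α} {Y : Ω → β} {X' : Ω → α'}
    {Y' : Ω → β'} (hX : SameKer q X X') (hY : SameKer q Y Y') :
    SameKer q (fun ω => (X ω, Y ω)) (fun ω => (X' ω, Y' ω)) := by
  intro ω ω' h h'
  simp only [Prod.mk.injEq, hX ω ω' h h', hY ω ω' h h']

theorem SameKer.refl (q : Ω → ℝ) (X : Ω → α) : SameKer q X X := fun _ _ _ _ => Iff.rfl

theorem SameKer.of_retract {q : Ω → ℝ} {X : Ω → α} {φ : α → β} {ψ : β → α}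
    (h : ∀ ω, q ω ≠ 0 → ψ (φ (X ω)) = X ω) : SameKer q (fun ω => φ (X ω)) X := by
  intro ω ω' h1 h2
  refine ⟨fun e => ?_, fun e => congrArg φ e⟩
  have := congrArg ψ e
  simpa only [h ω h1, h ω' h2] using this

variable [Fintype Ω]

/-- The self-information of `X` under `q`. -/
noncomputable def selfInfo (q : Ω → ℝ) (X : Ω → α) (ω : Ω) : ℝ :=
  -Real.logb 2 (push q X (X ω))

theorem entRV_eq_expVal [Fintype α] (q : Ω → ℝ) (X : Ω → α) :
    entRV q X = expVal q (selfInfo q X) := by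
  unfold entRV ent expVal selfInfo
  rw [sum_push_mul q X (fun a => Real.logb 2 (push q X a))]
  simp

theorem entRV_congr [Fintype α] [Fintype β] {q : Ω → ℝ} {X : Ω → α} {Y : Ω → β}
    (h : SameKer q X Y) : entRV q X = entRV q Y := by
  rw [entRV_eq_expVal, entRV_eq_expVal]
  refine Finset.sum_congr rfl fun ω _ => ?_
  by_cases hω : q ω = 0
  · simp [hω]
  · unfold selfInfo
    rw [push_congr fun ω' hω' => h ω' ω hω' hω]

theorem entRV_push [Fintype α] [Fintype β] (q : Ω → ℝ) (Φ : Ω → α) (X : α → β) :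
    entRV (push q Φ) X = entRV q (fun ω => X (Φ ω)) := by
  unfold entRV
  rw [push_push]

theorem entRV_comp_eq [Fintype α] [Fintype β] {q q' : Ω → ℝ} {Φ : Ω → α}
    (h : push q' Φ = push q Φ) (X : α → β) :
    entRV q' (fun ω => X (Φ ω)) = entRV q (fun ω => X (Φ ω)) := by
  rw [← entRV_push q' Φ X, ← entRV_push q Φ X, h]

variable [Fintype α] [Fintype β] [Fintype γ]

theorem condMI_push {δ : Type*} [Fintype δ] (q : Ω → ℝ) (Φ : Ω → δ) (X : δ → α) (Y : δ → β)
    (Z : δ → γ) : condMI (push q Φ) X Y Z =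
      condMI q (fun ω => X (Φ ω)) (fun ω => Y (Φ ω)) (fun ω => Z (Φ ω)) := by
  simp only [condMI, entRV_push]

theorem condMI_congr {α' β' γ' : Type*} [Fintype α'] [Fintype β'] [Fintype γ'] {q : Ω → ℝ}
    {X : Ω → α} {Y : Ω → β} {Z : Ω → γ} {X' : Ω → α'} {Y' : Ω → β'} {Z' : Ω → γ'}
    (hX : SameKer q X X') (hY : SameKer q Y Y') (hZ : SameKer q Z Z') :
    condMI q X Y Z = condMI q X' Y' Z' := by
  unfold condMI
  rw [entRV_congr (hX.prod hZ), entRV_congr (hY.prod hZ), entRV_congr (hX.prod (hY.prod hZ)),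
    entRV_congr hZ]

theorem sum_mul_ratio_le {q : Ω → ℝ} (hq : ∀ ω, 0 ≤ q ω) (X : Ω → α) (Y : Ω → β) (Z : Ω → γ) :
    ∑ ω, q ω * (push q (fun ω => (X ω, Z ω)) (X ω, Z ω) * push q (fun ω => (Y ω, Z ω)) (Y ω, Z ω) /
      (push q (fun ω => (X ω, Y ω, Z ω)) (X ω, Y ω, Z ω) * push q Z (Z ω))) ≤ ∑ ω, q ω := by
  rw [← sum_push_mul q (fun ω => (X ω, Y ω, Z ω)) (fun t =>
    push q (fun ω => (X ω, Z ω)) (t.1, t.2.2) * push q (fun ω => (Y ω, Z ω)) (t.2.1, t.2.2) /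
      (push q (fun ω => (X ω, Y ω, Z ω)) t * push q Z t.2.2))]
  calc _ ≤ ∑ t : α × β × γ, push q (fun ω => (X ω, Z ω)) (t.1, t.2.2) *
          push q (fun ω => (Y ω, Z ω)) (t.2.1, t.2.2) / push q Z t.2.2 := by
        refine Finset.sum_le_sum fun t _ => ?_
        by_cases ht : push q (fun ω => (X ω, Y ω, Z ω)) t = 0
        · rw [ht, zero_mul]
          exact div_nonneg (mul_nonneg (push_nonneg hq _ _) (push_nonneg hq _ _))
            (push_nonneg hq _ _)
        · rw [mul_div_mul_comm, ← mul_assoc, mul_div_cancel₀ _ ht, mul_div_assoc]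
    _ = ∑ z, push q Z z := by
        simp only [Fintype.sum_prod_type]
        rw [Finset.sum_congr rfl fun x _ => Finset.sum_comm, Finset.sum_comm]
        refine Finset.sum_congr rfl fun z _ => ?_
        simp_rw [← Finset.sum_div, ← Finset.mul_sum, sum_push_prod, ← Finset.sum_mul,
          sum_push_prod, mul_self_div_self]
    _ = ∑ ω, q ω := sum_push q Z

theorem condMI_nonneg {q : Ω → ℝ} (hq : ∀ ω, 0 ≤ q ω) (X : Ω → α) (Y : Ω → β) (Z : Ω → γ) :
    0 ≤ condMI q X Y Z := by
  have hl : 0 < Real.log 2 := Real.log_pos (by norm_num)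
  have key : ∑ ω, (q ω - q ω * (push q (fun ω => (X ω, Z ω)) (X ω, Z ω) *
      push q (fun ω => (Y ω, Z ω)) (Y ω, Z ω) /
      (push q (fun ω => (X ω, Y ω, Z ω)) (X ω, Y ω, Z ω) * push q Z (Z ω)))) / Real.log 2 ≤
      condMI q X Y Z := by
    unfold condMI
    simp only [entRV_eq_expVal, expVal, ← Finset.sum_add_distrib, ← Finset.sum_sub_distrib]
    refine Finset.sum_le_sum fun ω _ => ?_
    by_cases hω : q ω = 0
    · simp [hω]
    have h1 := push_pos hq (fun ω => (X ω, Z ω)) hω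
    have h2 := push_pos hq (fun ω => (Y ω, Z ω)) hω
    have h3 := push_pos hq (fun ω => (X ω, Y ω, Z ω)) hω
    have h4 := push_pos hq Z hω
    simp only [selfInfo, Real.logb]
    set a := push q (fun ω => (X ω, Z ω)) (X ω, Z ω)
    set b := push q (fun ω => (Y ω, Z ω)) (Y ω, Z ω)
    set e := push q (fun ω => (X ω, Y ω, Z ω)) (X ω, Y ω, Z ω)
    set f := push q Z (Z ω)
    have hlog := Real.log_le_sub_one_of_pos (div_pos (mul_pos h1 h2) (mul_pos h3 h4))
    rw [Real.log_div (mul_pos h1 h2).ne' (mul_pos h3 h4).ne', Real.log_mul h1.ne' h2.ne',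
      Real.log_mul h3.ne' h4.ne'] at hlog
    rw [div_le_iff₀ hl]
    have he : (q ω * -(Real.log a / Real.log 2) + q ω * -(Real.log b / Real.log 2) -
        q ω * -(Real.log e / Real.log 2) - q ω * -(Real.log f / Real.log 2)) * Real.log 2 =
        q ω * (Real.log e + Real.log f - Real.log a - Real.log b) := by
      field_simp
      ring
    rw [he]
    have := mul_le_mul_of_nonneg_left hlog (hq ω)
    linarith
  refine le_trans ?_ key
  rw [← Finset.sum_div, Finset.sum_sub_distrib]
  exact div_nonneg (sub_nonneg.2 (sum_mul_ratio_le hq X Y Z)) hl.le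

/-- Data processing: replacing `Y` by a function of `Y` and `Z` does not increase `I(X;Y|Z)`. -/
theorem condMI_comp_le {δ : Type*} [Fintype δ] {q : Ω → ℝ} (hq : ∀ ω, 0 ≤ q ω) (X : Ω → α)
    (Y : Ω → β) (Z : Ω → γ) (f : β → γ → δ) :
    condMI q X (fun ω => f (Y ω) (Z ω)) Z ≤ condMI q X Y Z := by
  have h := condMI_nonneg hq X Y (fun ω => (f (Y ω) (Z ω), Z ω))
  have h1 : entRV q (fun ω => (Y ω, f (Y ω) (Z ω), Z ω)) = entRV q (fun ω => (Y ω, Z ω)) :=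
    entRV_congr fun ω ω' _ _ => by simp only [Prod.mk.injEq]; grind
  have h2 : entRV q (fun ω => (X ω, Y ω, f (Y ω) (Z ω), Z ω)) =
      entRV q (fun ω => (X ω, Y ω, Z ω)) :=
    entRV_congr fun ω ω' _ _ => by simp only [Prod.mk.injEq]; grind
  unfold condMI at h ⊢
  linarith

end Entropy

section Reweight

variable {A B J : Type*} [Fintype Ω]

/-- The measure `q` with each outcome `ω` rescaled by `r (X ω)`. -/
def reweight (r : A → ℝ) (X : Ω → A) (q : Ω → ℝ) : Ω → ℝ := fun ω => r (X ω) * q ω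

omit [Fintype Ω] in
theorem reweight_nonneg {r : A → ℝ} (hr : ∀ a, 0 ≤ r a) (X : Ω → A) {q : Ω → ℝ}
    (hq : ∀ ω, 0 ≤ q ω) (ω : Ω) : 0 ≤ reweight r X q ω :=
  mul_nonneg (hr _) (hq ω)

omit [Fintype Ω] in
theorem ne_zero_of_reweight {r : A → ℝ} {X : Ω → A} {q : Ω → ℝ} {ω : Ω}
    (h : reweight r X q ω ≠ 0) : r (X ω) ≠ 0 ∧ q ω ≠ 0 :=
  ⟨left_ne_zero_of_mul h, right_ne_zero_of_mul h⟩

theorem push_reweight (r : A → ℝ) (x : α → A) (q : Ω → ℝ) (Y : Ω → α) (y : α) :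
    push (reweight r (fun ω => x (Y ω)) q) Y y = r (x y) * push q Y y := by
  simp only [push, reweight, Finset.mul_sum]
  refine Finset.sum_congr rfl fun ω _ => ?_
  split_ifs with h
  · rw [h]
  · simp

theorem expVal_reweight [Fintype A] (r : A → ℝ) (X : Ω → A) (q : Ω → ℝ) (f : Ω → ℝ) :
    expVal (reweight r X q) f = ∑ a, r a * push (fun ω => q ω * f ω) X a := by
  have := sum_push_mul (fun ω => q ω * f ω) X r
  simp only [expVal, reweight]
  rw [← Finset.sum_congr rfl fun a _ => mul_comm _ (r a), this]
  exact Finset.sum_congr rfl fun ω _ => by ring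

theorem push_reweight_eq_sum [Fintype A] (r : A → ℝ) (X : Ω → A) (q : Ω → ℝ) (Y : Ω → B) (b : B) :
    push (reweight r X q) Y b = ∑ a, r a * push (fun ω => q ω * if Y ω = b then 1 else 0) X a := by
  rw [← expVal_reweight, push_eq_sum_mul]
  rfl

theorem entRV_reweight [Fintype α] {r : A → ℝ} {q : Ω → ℝ} (hq : ∀ ω, 0 ≤ q ω) {X : Ω → A}
    (Y : Ω → α) (x : α → A) (hx : ∀ ω, x (Y ω) = X ω) :
    entRV (reweight r X q) Y = expVal (reweight r X q) (selfInfo q Y) +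
      expVal (reweight r X q) (fun ω => -Real.logb 2 (r (X ω))) := by
  obtain rfl : (fun ω => x (Y ω)) = X := funext hx
  rw [entRV_eq_expVal]
  unfold expVal
  rw [← Finset.sum_add_distrib]
  refine Finset.sum_congr rfl fun ω _ => ?_
  by_cases h : reweight r (fun ω => x (Y ω)) q ω = 0
  · simp [h]
  · obtain ⟨h1, h2⟩ := ne_zero_of_reweight h
    rw [← mul_add]
    unfold selfInfo
    rw [push_reweight, Real.logb_mul h1 (push_pos hq Y h2).ne']
    ring

theorem expVal_add (q f g : Ω → ℝ) : expVal q (fun ω => f ω + g ω) = expVal q f + expVal q g := by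
  simp [expVal, mul_add, Finset.sum_add_distrib]

theorem expVal_sub (q f g : Ω → ℝ) : expVal q (fun ω => f ω - g ω) = expVal q f - expVal q g := by
  simp [expVal, mul_sub, Finset.sum_sub_distrib]

/-- Support reduction for the values of `X`: the law of `Y` and the expectations of the `F j` are
kept, the expectation of `c` does not increase, and at most `|B| + |J|` values of `X` survive. -/
theorem exists_reweight [Fintype A] [Fintype B] [Fintype J] {q : Ω → ℝ} (hq : ∀ ω, 0 ≤ q ω)
    (X : Ω → A) (Y : Ω → B) (F : J → Ω → ℝ) (c : Ω → ℝ) :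
    ∃ r : A → ℝ, (∀ a, 0 ≤ r a) ∧ #{a | r a ≠ 0} ≤ Fintype.card B + Fintype.card J ∧
      push (reweight r X q) Y = push q Y ∧
      (∀ j, expVal (reweight r X q) (F j) = expVal q (F j)) ∧
      expVal (reweight r X q) c ≤ expVal q c := by
  let w : A → ℝ := fun a => if push q X a = 0 then 0 else 1
  have hw1 : reweight w X q = q := by
    ext ω
    by_cases h : q ω = 0
    · simp [reweight, h]
    · simp [reweight, w, (push_pos hq X h).ne']
  let G : B ⊕ J → Ω → ℝ := Sum.elim (fun b ω => if Y ω = b then 1 else 0) F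
  obtain ⟨r, h1, h2, h3, h4⟩ := exists_sparse_weights
    (fun j a => push (fun ω => q ω * G j ω) X a) (fun a => push (fun ω => q ω * c ω) X a)
    (Sum.elim (fun _ => 1) (fun _ => 0)) (Fintype.card A) w
    (fun a => by simp only [w]; split_ifs <;> norm_num)
    (fun a ha => by
      have ha' : push q X a ≠ 0 := fun h => ha (by simp [w, h])
      have : ∑ j, (Sum.elim (fun _ => 1) (fun _ => 0) : B ⊕ J → ℝ) j *
          push (fun ω => q ω * G j ω) X a = push q X a := by
        simp only [Fintype.sum_sum_type, Sum.elim_inl, Sum.elim_inr, one_mul, zero_mul,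
          Finset.sum_const_zero, add_zero, G, push]
        rw [Finset.sum_comm]
        refine Finset.sum_congr rfl fun ω _ => ?_
        split_ifs <;> simp
      rw [this]
      exact lt_of_le_of_ne (push_nonneg hq X a) ha'.symm)
    (Finset.card_le_univ _)
  refine ⟨r, h1, by simpa using h2, ?_, fun j => ?_, ?_⟩
  · ext b
    conv_rhs => rw [← hw1]
    rw [push_reweight_eq_sum, push_reweight_eq_sum]
    exact h3 (Sum.inl b)
  · conv_rhs => rw [← hw1]
    rw [expVal_reweight, expVal_reweight]
    exact h3 (Sum.inr j)
  · conv_rhs => rw [← hw1]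
    rw [expVal_reweight, expVal_reweight]
    exact h4

end Reweight

section Markov

variable [Fintype Ω]

theorem push_comp_prod_reweight {A T : Type*} [Fintype A] (r : A → ℝ) (X : Ω → A) (Y : Ω → T)
    (q : Ω → ℝ) (f : A → T → β) (b : β) (t : T) :
    push (reweight r X q) (fun ω => (f (X ω) (Y ω), Y ω)) (b, t) =
      ∑ a, if f a t = b then r a * push q (fun ω => (X ω, Y ω)) (a, t) else 0 := by
  have hite : ∀ a, (if f a t = b then r a * push q (fun ω => (X ω, Y ω)) (a, t) else 0) =
      ∑ ω, if f a t = b then r a * (if X ω = a ∧ Y ω = t then q ω else 0) else 0 := by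
    intro a
    split_ifs
    · simp only [push, Prod.mk.injEq, Finset.mul_sum]
    · simp
  rw [Finset.sum_congr rfl fun a _ => hite a]
  simp only [push, reweight, Prod.mk.injEq]
  rw [Finset.sum_comm]
  refine Finset.sum_congr rfl fun ω _ => ?_
  rw [Finset.sum_eq_single (X ω)]
  · by_cases h : Y ω = t
    · subst h; simp
    · simp [h]
  · intro a _ ha
    simp [ha.symm]
  · simp

theorem MarkovChain.reweight_comp {q : Ω → ℝ} [Fintype α] {X : Ω → α} {Y : Ω → β} {Z : Ω → γ}
    (h : MarkovChain q X Y Z) (r : α → ℝ) {δ : Type*} (f : α → β → δ) (x : δ) (y : β) (z : γ) :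
    push (reweight r X q) (fun ω => (f (X ω) (Y ω), Y ω, Z ω)) (x, y, z) * push q Y y =
      push (reweight r X q) (fun ω => (f (X ω) (Y ω), Y ω)) (x, y) *
        push q (fun ω => (Z ω, Y ω)) (z, y) := by
  rw [push_comp_prod_reweight r X (fun ω => (Y ω, Z ω)) q (fun a t => f a t.1),
    push_comp_prod_reweight, Finset.sum_mul, Finset.sum_mul]
  refine Finset.sum_congr rfl fun a _ => ?_
  split_ifs
  · rw [mul_assoc, h a y z, mul_assoc]
  · simp

theorem MarkovChain.comp_left {q : Ω → ℝ} [Fintype α] {X : Ω → α} {Y : Ω → β} {Z : Ω → γ}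
    (h : MarkovChain q X Y Z) {δ : Type*} (f : α → β → δ) :
    MarkovChain q (fun ω => f (X ω) (Y ω)) Y Z := by
  intro x y z
  have := h.reweight_comp (fun _ => 1) f x y z
  have h1 : reweight (fun _ : α => (1 : ℝ)) X q = q := by ext; simp [reweight]
  rwa [h1] at this

theorem MarkovChain.symm {q : Ω → ℝ} {X : Ω → α} {Y : Ω → β} {Z : Ω → γ}
    (h : MarkovChain q X Y Z) : MarkovChain q Z Y X := by
  intro z y x
  rw [mul_comm (push q _ (z, y)), ← h x y z,
    push_congr (X := fun ω => (Z ω, Y ω, X ω)) (Y := fun ω => (X ω, Y ω, Z ω)) (b := (x, y, z))]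
  intro ω _
  simp only [Prod.mk.injEq]
  tauto

theorem MarkovChain.comp_mid {q : Ω → ℝ} {X : Ω → α} {Y : Ω → β} {Z : Ω → γ}
    (h : MarkovChain q X Y Z) {δ : Type*} (φ : β → δ) (ψ : δ → β)
    (hψ : ∀ ω, q ω ≠ 0 → ψ (φ (Y ω)) = Y ω) : MarkovChain q X (fun ω => φ (Y ω)) Z := by
  intro x y z
  have key : ∀ ω, q ω ≠ 0 → φ (ψ y) = y → (φ (Y ω) = y ↔ Y ω = ψ y) := by
    intro ω hω hy
    refine ⟨fun e => ?_, fun e => by rw [e, hy]⟩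
    rw [← e, hψ ω hω]
  by_cases hy : φ (ψ y) = y
  · rw [push_congr (q := q) (X := fun ω => (X ω, φ (Y ω), Z ω)) (Y := fun ω => (X ω, Y ω, Z ω))
        (b := (x, ψ y, z)),
      push_congr (q := q) (X := fun ω => φ (Y ω)) (Y := Y) (b := ψ y),
      push_congr (q := q) (X := fun ω => (X ω, φ (Y ω))) (Y := fun ω => (X ω, Y ω))
        (b := (x, ψ y)),
      push_congr (q := q) (X := fun ω => (Z ω, φ (Y ω))) (Y := fun ω => (Z ω, Y ω))
        (b := (z, ψ y)), h x (ψ y) z]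
    all_goals
      intro ω hω
      simp only [Prod.mk.injEq, key ω hω hy]
  · have h0 : ∀ ω, q ω ≠ 0 → φ (Y ω) ≠ y := by
      intro ω hω e
      apply hy
      rw [← e, hψ ω hω]
    have h1 : push q (fun ω => (X ω, φ (Y ω), Z ω)) (x, y, z) = 0 := by
      by_contra hne
      obtain ⟨ω, hω, hq⟩ := exists_of_push_ne_zero hne
      exact h0 ω hq (by simp only [Prod.mk.injEq] at hω; exact hω.2.1)
    have h2 : push q (fun ω => (X ω, φ (Y ω))) (x, y) = 0 := by
      by_contra hne
      obtain ⟨ω, hω, hq⟩ := exists_of_push_ne_zero hne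
      exact h0 ω hq (by simp only [Prod.mk.injEq] at hω; exact hω.2)
    rw [h1, h2, zero_mul, zero_mul]

theorem markovChain_push [Fintype α] {δ₁ δ₂ δ₃ : Type*} {q : Ω → ℝ} {Φ : Ω → α} {X : α → δ₁}
    {Y : α → δ₂} {Z : α → δ₃} : MarkovChain (push q Φ) X Y Z ↔
      MarkovChain q (fun ω => X (Φ ω)) (fun ω => Y (Φ ω)) (fun ω => Z (Φ ω)) := by
  simp only [MarkovChain, push_push]

/-- Rescaling by a function of the middle variable keeps a Markov chain. -/
theorem MarkovChain.reweight_mid {A : Type*} {q : Ω → ℝ} {X : Ω → α} {Y : Ω → β} {Z : Ω → γ}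
    (h : MarkovChain q X Y Z) (r : A → ℝ) (x : β → A) :
    MarkovChain (reweight r (fun ω => x (Y ω)) q) X Y Z := by
  intro a b c
  rw [push_reweight r (fun t : α × β × γ => x t.2.1) q (fun ω => (X ω, Y ω, Z ω)),
    push_reweight r x, push_reweight r (fun t : α × β => x t.2) q (fun ω => (X ω, Y ω)),
    push_reweight r (fun t : γ × β => x t.2) q (fun ω => (Z ω, Y ω))]
  linear_combination r (x b) * r (x b) * h a b c

/-- Rescaling by an outer variable keeps a Markov chain if it keeps the law of the others. -/
theorem MarkovChain.reweight_right {q : Ω → ℝ} [Fintype α] [Fintype β] {X : Ω → α} {Y : Ω → β}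
    {Z : Ω → γ}
    (h : MarkovChain q X Y Z) (r : γ → ℝ)
    (hr : push (reweight r Z q) (fun ω => (X ω, Y ω)) = push q (fun ω => (X ω, Y ω))) :
    MarkovChain (reweight r Z q) X Y Z := by
  intro a b c
  have hY : push (reweight r Z q) Y = push q Y := by
    have := congrArg (fun m => push m Prod.snd) hr
    simpa only [push_push] using this
  rw [push_reweight r (fun t : α × β × γ => t.2.2) q (fun ω => (X ω, Y ω, Z ω)), hr, hY,
    push_reweight r (fun t : γ × β => t.1) q (fun ω => (Z ω, Y ω))]
  linear_combination r c * h a b c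

end Markov

section Admissible

variable {S T : Type*} [Fintype S] [Fintype T] [Fintype α]

/-- Joint pmfs of an auxiliary variable and a source with law `p` on `S × T`, such that the
auxiliary variable depends on the source only through its first component. -/
def Admissible (p : S × T → ℝ) (q : α × S × T → ℝ) : Prop :=
  (∀ ω, 0 ≤ q ω) ∧ (∀ y, push q (fun x => x.2) y = p y) ∧
    MarkovChain q (fun x => x.1) (fun x => x.2.1) (fun x => x.2.2)

theorem Admissible.isPMF {p : S × T → ℝ} (hp : IsPMF p) {q : α × S × T → ℝ}
    (hq : Admissible p q) : IsPMF q := by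
  refine ⟨hq.1, ?_⟩
  rw [← sum_push q (fun x => x.2), ← hp.2]
  exact Finset.sum_congr rfl fun y _ => hq.2.1 y

theorem Admissible.map [Fintype β] {p : S × T → ℝ} {q : α × S × T → ℝ} (hq : Admissible p q)
    (φ : α → β) : Admissible p (push q (fun ω => (φ ω.1, ω.2))) := by
  refine ⟨push_nonneg hq.1 _, fun y => ?_, ?_⟩
  · rw [push_push]
    exact hq.2.1 y
  · rw [markovChain_push]
    exact hq.2.2.comp_left (fun a _ => φ a)

theorem Admissible.reweight_push {A : Type*} {p : S × T → ℝ} {q : α × S × T → ℝ}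
    (hq : Admissible p q) {r : A → ℝ} {x : α → A} {y : α → β}
    (h : push (reweight r (fun ω => x ω.1) q) (fun ω => (y ω.1, ω.2.1)) =
      push q (fun ω => (y ω.1, ω.2.1))) :
    push (reweight r (fun ω => x ω.1) q) (fun ω => (y ω.1, ω.2)) =
      push q (fun ω => (y ω.1, ω.2)) := by
  ext ⟨b, s, t⟩
  have h1 := hq.2.2.reweight_comp (fun a => r (x a)) (fun a _ => y a) b s t
  have h2 := hq.2.2.comp_left (fun a _ => y a) b s t
  have h3 : push (reweight r (fun ω => x ω.1) q) (fun ω => (y ω.1, ω.2)) (b, s, t) *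
      push q (fun ω => ω.2.1) s = push q (fun ω => (y ω.1, ω.2)) (b, s, t) *
      push q (fun ω => ω.2.1) s := by
    refine h1.trans (Eq.trans ?_ h2.symm)
    exact congrArg (· * _) (congrFun h (b, s))
  by_cases hs : push q (fun ω => ω.2.1) s = 0
  · have h0 : ∀ ω : α × S × T, ω.2.1 = s → q ω = 0 := by
      intro ω hω
      by_contra hne
      have := push_pos hq.1 (fun ω => ω.2.1) hne
      rw [hω, hs] at this
      exact lt_irrefl _ this
    refine Finset.sum_congr rfl fun ω _ => ?_
    split_ifs with he
    · have := h0 ω (by simp only [Prod.ext_iff] at he; exact he.2.1)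
      simp [reweight, this]
    · rfl
  · exact mul_right_cancel₀ hs h3

theorem Admissible.reweight {A : Type*} [Fintype β] {p : S × T → ℝ} {q : α × S × T → ℝ}
    (hq : Admissible p q) {r : A → ℝ} (hr : ∀ a, 0 ≤ r a) {x : α → A} {y : α → β}
    (h : push (reweight r (fun ω => x ω.1) q) (fun ω => (y ω.1, ω.2)) =
      push q (fun ω => (y ω.1, ω.2))) :
    Admissible p (reweight r (fun ω => x ω.1) q) := by
  have h2 : push (CRR.reweight r (fun ω => x ω.1) q) (fun ω => ω.2) =
      push q (fun ω => ω.2) := by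
    have := congrArg (fun m => push m Prod.snd) h
    simpa only [push_push] using this
  refine ⟨reweight_nonneg hr _ hq.1, fun z => by rw [h2, hq.2.1], ?_⟩
  refine (MarkovChain.reweight_right hq.2.2.symm (fun a => r (x a)) ?_).symm
  have := congrArg (fun m => push m (fun z : S × T => (z.2, z.1))) h2
  simp only [push_push] at this
  exact this

end Admissible

section Reconstruction

variable {S W : Type*} [Fintype Ω]

/-- The decoders observing `L` and `R` have reconstruction maps that agree almost surely and meet
the distortion level `D`. -/
def Reconstructible (q : Ω → ℝ) (L : Ω → α) (R : Ω → β) (σ : Ω → S) (d : S → W → ℝ) (D : ℝ) :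
    Prop :=
  ∃ (h : β → W) (h' : α → W), (∀ ω, q ω ≠ 0 → h' (L ω) = h (R ω)) ∧
    expVal q (fun ω => d (σ ω) (h (R ω))) ≤ D

omit [Fintype Ω] in
theorem GKConn.symm {m : α × β → ℝ} {y₁ y₂ : β} (h : GKConn m y₁ y₂) : GKConn m y₂ y₁ :=
  have : Std.Symm (GKStep m) := ⟨fun _ _ ⟨x, h1, h2⟩ => ⟨x, h2, h1⟩⟩
  Std.Symm.symm (r := Relation.ReflTransGen (GKStep m)) _ _ h

omit [Fintype Ω] in
theorem exists_isGKMap (m : α × β → ℝ) :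
    ∃ g : β → β, IsGKMap m g ∧ ∀ y, GKConn m (g y) y := by
  let s : Setoid β := ⟨GKConn m, fun _ => Relation.ReflTransGen.refl, GKConn.symm,
    Relation.ReflTransGen.trans⟩
  refine ⟨fun y => (Quotient.mk s y).out, fun y₁ y₂ => ?_, fun y => Quotient.mk_out (s := s) y⟩
  rw [Quotient.out_inj, Quotient.eq]
  rfl

/-- Reconstruction from the Gács–Körner common randomness amounts to two agreeing decoders. -/
theorem exists_gk_reconstruction_iff {q : Ω → ℝ} (hq : IsPMF q) (L : Ω → α) (R : Ω → β)
    (σ : Ω → S) (d : S → W → ℝ) (D : ℝ) :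
    (∃ (g : β → β) (f : β → W), IsGKMap (push q (fun ω => (L ω, R ω))) g ∧
      expVal q (fun ω => d (σ ω) (f (g (R ω)))) ≤ D) ↔ Reconstructible q L R σ d D := by
  constructor
  · rintro ⟨g, f, hg, hD⟩
    obtain ⟨ω₀⟩ : Nonempty Ω := by
      by_contra h
      rw [not_nonempty_iff] at h
      simpa using hq.2
    let h' : α → W := fun l =>
      if hl : ∃ ω, q ω ≠ 0 ∧ L ω = l then f (g (R hl.choose)) else f (g (R ω₀))
    refine ⟨fun y => f (g y), h', fun ω hω => ?_, hD⟩
    have hl : ∃ ω', q ω' ≠ 0 ∧ L ω' = L ω := ⟨ω, hω, rfl⟩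
    simp only [h', dif_pos hl]
    congr 1
    refine (hg _ _).2 (Relation.ReflTransGen.single ⟨L ω, ?_, ?_⟩)
    · have := push_pos hq.1 (fun ω => (L ω, R ω)) hl.choose_spec.1
      rwa [hl.choose_spec.2] at this
    · exact push_pos hq.1 (fun ω => (L ω, R ω)) hω
  · rintro ⟨h, h', hh, hD⟩
    obtain ⟨g, hg, hgc⟩ := exists_isGKMap (push q (fun ω => (L ω, R ω)))
    have hconst : ∀ y₁ y₂, GKConn (push q (fun ω => (L ω, R ω))) y₁ y₂ → h y₁ = h y₂ := by
      intro y₁ y₂ hc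
      induction hc with
      | refl => rfl
      | tail _ hs ih =>
        obtain ⟨x, h1, h2⟩ := hs
        obtain ⟨ω₁, e1, n1⟩ := exists_of_push_ne_zero h1.ne'
        obtain ⟨ω₂, e2, n2⟩ := exists_of_push_ne_zero h2.ne'
        simp only [Prod.mk.injEq] at e1 e2
        rw [ih, ← e1.2, ← e2.2, ← hh ω₁ n1, ← hh ω₂ n2, e1.1, e2.1]
    refine ⟨g, h, hg, ?_⟩
    simpa only [hconst _ _ (hgc _)] using hD

theorem Reconstructible.push {Ω' α' β' : Type*} [Fintype Ω'] {q : Ω → ℝ} {L : Ω → α}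
    {R : Ω → β} {σ : Ω → S} {d : S → W → ℝ} {D : ℝ} (hr : Reconstructible q L R σ d D)
    (Φ : Ω → Ω') (L' : Ω' → α') (R' : Ω' → β') (σ' : Ω' → S) (l : α' → α) (ρ : β' → β)
    (hL : ∀ ω, q ω ≠ 0 → l (L' (Φ ω)) = L ω) (hR : ∀ ω, q ω ≠ 0 → ρ (R' (Φ ω)) = R ω)
    (hσ : ∀ ω, σ' (Φ ω) = σ ω) : Reconstructible (push q Φ) L' R' σ' d D := by
  obtain ⟨h, h', hh, hD⟩ := hr
  refine ⟨fun y => h (ρ y), fun y => h' (l y), fun ω' hω' => ?_, ?_⟩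
  · obtain ⟨ω, rfl, hω⟩ := exists_of_push_ne_zero hω'
    simp only [hL ω hω, hR ω hω, hh ω hω]
  · rw [expVal_push]
    refine le_of_eq_of_le (Finset.sum_congr rfl fun ω _ => ?_) hD
    by_cases hω : q ω = 0
    · simp [hω]
    · simp only [hR ω hω, hσ]

/-- A renaming with `n` symbols that is injective on a set of at most `n` symbols. -/
theorem exists_rename {A B : Type*} [Fintype B] (s : Finset A) (hs : s.Nonempty)
    (hn : #s ≤ Fintype.card B) : ∃ (φ : A → B) (ψ : B → A), ∀ a ∈ s, ψ (φ a) = a := by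
  obtain ⟨e⟩ : Nonempty (s ↪ B) := Function.Embedding.nonempty_of_card_le (by simpa using hn)
  obtain ⟨a₀, ha₀⟩ := hs
  refine ⟨fun a => if h : a ∈ s then e ⟨a, h⟩ else e ⟨a₀, ha₀⟩,
    fun b => if h : ∃ a, e a = b then h.choose else a₀, fun a ha => ?_⟩
  have h : ∃ a', e a' = e ⟨a, ha⟩ := ⟨_, rfl⟩
  simp only [dif_pos ha, dif_pos h]
  rw [e.injective h.choose_spec]

end Reconstruction

section ReweightedInformation

variable {A S : Type*} [Fintype Ω] [Fintype α] [Fintype β] [Fintype γ]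

omit [Fintype β] in
theorem push_comp_eq {q q' : Ω → ℝ} {Φ : Ω → α} (h : push q' Φ = push q Φ) (X : α → β) :
    push q' (fun ω => X (Φ ω)) = push q (fun ω => X (Φ ω)) := by
  rw [← push_push q' Φ X, ← push_push q Φ X, h]

theorem condMI_comp_eq {δ : Type*} [Fintype δ] {q q' : Ω → ℝ} {Φ : Ω → δ}
    (h : push q' Φ = push q Φ) (X : δ → α) (Y : δ → β) (Z : δ → γ) :
    condMI q' (fun ω => X (Φ ω)) (fun ω => Y (Φ ω)) (fun ω => Z (Φ ω)) =
      condMI q (fun ω => X (Φ ω)) (fun ω => Y (Φ ω)) (fun ω => Z (Φ ω)) := by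
  rw [← condMI_push q' Φ X Y Z, ← condMI_push q Φ X Y Z, h]

/-- The part of the density of `I(X;Y|Z)` that involves `Y`. -/
noncomputable def partialInfo (q : Ω → ℝ) (X : Ω → α) (Y : Ω → β) (Z : Ω → γ) (ω : Ω) : ℝ :=
  selfInfo q (fun ω => (Y ω, Z ω)) ω - selfInfo q (fun ω => (X ω, Y ω, Z ω)) ω

/-- The density of `I(X;Y|Z)`. -/
noncomputable def infoDensity (q : Ω → ℝ) (X : Ω → α) (Y : Ω → β) (Z : Ω → γ) (ω : Ω) : ℝ :=
  selfInfo q (fun ω => (X ω, Z ω)) ω + selfInfo q (fun ω => (Y ω, Z ω)) ω -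
    selfInfo q (fun ω => (X ω, Y ω, Z ω)) ω - selfInfo q Z ω

theorem condMI_eq_expVal_infoDensity (q : Ω → ℝ) (X : Ω → α) (Y : Ω → β) (Z : Ω → γ) :
    condMI q X Y Z = expVal q (infoDensity q X Y Z) := by
  unfold condMI infoDensity
  simp only [expVal_sub, expVal_add, entRV_eq_expVal]

/-- If `Z` determines the reweighting, then `I(X;Y|Z)` is linear in the weights. -/
theorem condMI_reweight_of_cond {q : Ω → ℝ} (hq : ∀ ω, 0 ≤ q ω) (r : A → ℝ) (T : Ω → A)
    (X : Ω → α) (Y : Ω → β) (Z : Ω → γ) (t : γ → A) (ht : ∀ ω, t (Z ω) = T ω) :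
    condMI (reweight r T q) X Y Z = expVal (reweight r T q) (infoDensity q X Y Z) := by
  unfold condMI infoDensity
  rw [entRV_reweight hq (fun ω => (X ω, Z ω)) (fun z => t z.2) ht,
    entRV_reweight hq (fun ω => (Y ω, Z ω)) (fun z => t z.2) ht,
    entRV_reweight hq (fun ω => (X ω, Y ω, Z ω)) (fun z => t z.2.2) ht,
    entRV_reweight hq Z t ht]
  simp only [expVal_sub, expVal_add]
  ring

/-- If `(Y, Z)` determines the reweighting and the law of `(X, Z)` is kept, then `I(X;Y|Z)`
is affine in the weights. -/
theorem condMI_reweight_sub {q : Ω → ℝ} (hq : ∀ ω, 0 ≤ q ω) (r : A → ℝ) (T : Ω → A)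
    (X : Ω → α) (Y : Ω → β) (Z : Ω → γ) (t : β → A) (ht : ∀ ω, t (Y ω) = T ω)
    (h : push (reweight r T q) (fun ω => (X ω, Z ω)) = push q (fun ω => (X ω, Z ω))) :
    condMI (reweight r T q) X Y Z - condMI q X Y Z =
      expVal (reweight r T q) (partialInfo q X Y Z) - expVal q (partialInfo q X Y Z) := by
  unfold condMI partialInfo
  have hZ : entRV (reweight r T q) Z = entRV q Z := entRV_comp_eq h Prod.snd
  have hXZ : entRV (reweight r T q) (fun ω => (X ω, Z ω)) = entRV q (fun ω => (X ω, Z ω)) :=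
    entRV_comp_eq h id
  rw [entRV_reweight hq (fun ω => (Y ω, Z ω)) (fun z => t z.1) ht,
    entRV_reweight hq (fun ω => (X ω, Y ω, Z ω)) (fun z => t z.2.1) ht, hZ, hXZ,
    entRV_eq_expVal q (fun ω => (Y ω, Z ω)), entRV_eq_expVal q (fun ω => (X ω, Y ω, Z ω))]
  simp only [expVal_sub]
  ring

end ReweightedInformation

section SingleAuxiliary

variable {S U V W : Type*} [Fintype S] [Fintype U] [Fintype V]

theorem RStar_subset {p : S × U × V → ℝ} (hp : IsPMF p) (d : S → W → ℝ) (D : ℝ) (k : ℕ) :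
    RStar p d D k ⊆ RStar p d D (Fintype.card S + 2) := by
  rintro r₀ ⟨hr1, hr2, q, ⟨hpmf, hmarg, hM, hrec⟩, hR1, hR2⟩
  have hadm : Admissible p q := ⟨hpmf.1, hmarg, hM⟩
  obtain ⟨h, h', hh, hD⟩ := (exists_gk_reconstruction_iff hpmf (fun x => (x.1, x.2.2.1))
    (fun x => (x.1, x.2.2.2)) (fun x => x.2.1) d D).1 hrec
  obtain ⟨r, hr, hcard, hlaw, hF, hc⟩ := exists_reweight hpmf.1 (fun x => x.1)
    (fun x => ((), x.2.1))
    ![partialInfo q (fun x => x.2.1) (fun x => x.1) (fun x => x.2.2.1),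
      partialInfo q (fun x => x.2.1) (fun x => x.1) (fun x => x.2.2.2)]
    (fun x => d x.2.1 (h (x.1, x.2.2.2)))
  have hlaw' := hadm.reweight_push (x := fun a => a) (y := fun _ => ()) hlaw
  have hadm' := hadm.reweight (x := fun a => a) (y := fun _ => ()) hr hlaw'
  set q₁ := reweight r (fun x => x.1) q with hq₁
  have e1 := condMI_reweight_sub hpmf.1 r (fun x => x.1) (fun x => x.2.1) (fun x => x.1)
    (fun x => x.2.2.1) id (fun _ => rfl) (push_comp_eq hlaw' fun z => (z.2.1, z.2.2.1))
  have e2 := condMI_reweight_sub hpmf.1 r (fun x => x.1) (fun x => x.2.1) (fun x => x.1)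
    (fun x => x.2.2.2) id (fun _ => rfl) (push_comp_eq hlaw' fun z => (z.2.1, z.2.2.2))
  have f1 := hF 0
  have f2 := hF 1
  simp only [Matrix.cons_val_zero, Matrix.cons_val_one] at f1 f2
  have hpmf₁ := hadm'.isPMF hp
  obtain ⟨ω₀, hω₀⟩ : ∃ ω, q₁ ω ≠ 0 := by
    by_contra! h0
    simpa [h0] using hpmf₁.2
  have hs : ∀ ω, q₁ ω ≠ 0 → ω.1 ∈ ({a | r a ≠ 0} : Finset _) := fun ω hω => by
    simpa using (ne_zero_of_reweight hω).1
  obtain ⟨φ, ψ, hψ⟩ := exists_rename (B := Fin (Fintype.card S + 2)) {a | r a ≠ 0}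
    ⟨ω₀.1, hs ω₀ hω₀⟩ (by simpa using hcard)
  have hret : ∀ ω, q₁ ω ≠ 0 → ψ (φ ω.1) = ω.1 := fun ω hω => hψ _ (hs ω hω)
  have hrec₁ : Reconstructible q₁ (fun x => (x.1, x.2.2.1)) (fun x => (x.1, x.2.2.2))
      (fun x => x.2.1) d D :=
    ⟨h, h', fun ω hω => hh ω (ne_zero_of_reweight hω).2, hc.trans hD⟩
  have hadm₂ := hadm'.map φ
  have hrec₂ := hrec₁.push (fun ω => (φ ω.1, ω.2)) (fun x => (x.1, x.2.2.1))
    (fun x => (x.1, x.2.2.2)) (fun x => x.2.1) (fun z => (ψ z.1, z.2)) (fun z => (ψ z.1, z.2))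
    (fun ω hω => by simp only [hret ω hω]) (fun ω hω => by simp only [hret ω hω]) (fun _ => rfl)
  refine ⟨hr1, hr2, push q₁ (fun ω => (φ ω.1, ω.2)), ⟨hadm₂.isPMF hp, hadm₂.2.1, hadm₂.2.2,
    (exists_gk_reconstruction_iff (hadm₂.isPMF hp) _ _ _ _ _).2 hrec₂⟩, ?_, ?_⟩
  · rw [condMI_push, condMI_congr (SameKer.refl _ _) (SameKer.of_retract hret) (SameKer.refl _ _)]
    linarith
  · rw [condMI_push, condMI_congr (SameKer.refl _ _) (SameKer.of_retract hret) (SameKer.refl _ _)]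
    linarith

end SingleAuxiliary

section TripleAuxiliary

variable {A B C S U V W : Type*} [Fintype A] [Fintype B] [Fintype C] [Fintype S] [Fintype U]
  [Fintype V]

/-- Admissible laws of three auxiliary variables that allow reconstruction at distortion `D`. -/
def Feasible (p : S × U × V → ℝ) (d : S → W → ℝ) (D : ℝ)
    (q : (A × B × C) × S × U × V → ℝ) : Prop :=
  Admissible p q ∧ Reconstructible q (fun x => (x.1.1, x.1.2.1, x.2.2.1))
    (fun x => (x.1.1, x.1.2.2, x.2.2.2)) (fun x => x.2.1) d D

/-- The information quantity `I(S;A,B|U)`. -/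
noncomputable def commonRate (q : (A × B × C) × S × U × V → ℝ) : ℝ :=
  condMI q (fun x => x.2.1) (fun x => (x.1.1, x.1.2.1)) (fun x => x.2.2.1)

/-- The information quantity `I(S;B|A,C,U,V) + I(S;A,C|V)`. -/
noncomputable def sumRateDdag (q : (A × B × C) × S × U × V → ℝ) : ℝ :=
  condMI q (fun x => x.2.1) (fun x => x.1.2.1) (fun x => (x.1.1, x.1.2.2, x.2.2)) +
    condMI q (fun x => x.2.1) (fun x => (x.1.1, x.1.2.2)) (fun x => x.2.2.2)

/-- The information quantity `max {I(S;A|U), I(S;A|V)} + I(S;B|A,U) + I(S;C|A,V)`. -/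
noncomputable def sumRateDag (q : (A × B × C) × S × U × V → ℝ) : ℝ :=
  max (condMI q (fun x => x.2.1) (fun x => x.1.1) (fun x => x.2.2.1))
      (condMI q (fun x => x.2.1) (fun x => x.1.1) (fun x => x.2.2.2)) +
    condMI q (fun x => x.2.1) (fun x => x.1.2.1) (fun x => (x.1.1, x.2.2.1)) +
    condMI q (fun x => x.2.1) (fun x => x.1.2.2) (fun x => (x.1.1, x.2.2.2))

/-- The Markov chain `B – (A,S) – C`. -/
def CondIndep (q : (A × B × C) × S × U × V → ℝ) : Prop :=
  MarkovChain q (fun x => x.1.2.1) (fun x => (x.1.1, x.2.1)) (fun x => x.1.2.2)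

theorem PDdag_iff_feasible {p : S × U × V → ℝ} (hp : IsPMF p) (d : S → W → ℝ) (D : ℝ) (k : ℕ)
    (q : (Fin k × Fin k × Fin k) × S × U × V → ℝ) : PDdag p d D k q ↔ Feasible p d D q := by
  constructor
  · rintro ⟨h1, h2, h3, h4⟩
    exact ⟨⟨h1.1, h2, h3⟩, (exists_gk_reconstruction_iff h1 _ _ _ _ _).1 h4⟩
  · rintro ⟨h1, h2⟩
    exact ⟨h1.isPMF hp, h1.2.1, h1.2.2,
      (exists_gk_reconstruction_iff (h1.isPMF hp) _ _ _ _ _).2 h2⟩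

theorem Admissible.exists_ne_zero {p : S × U × V → ℝ} (hp : IsPMF p) {q : α × S × U × V → ℝ}
    [Fintype α] (hq : Admissible p q) : ∃ ω, q ω ≠ 0 := by
  by_contra! h0
  simpa [h0] using (hq.isPMF hp).2

/-- The three auxiliary variables can be renamed by injections on their supports. -/
theorem Feasible.exists_rename {A' B' C' : Type*} [Fintype A'] [Fintype B'] [Fintype C']
    {p : S × U × V → ℝ} (hp : IsPMF p) {d : S → W → ℝ} {D : ℝ}
    {q : (A × B × C) × S × U × V → ℝ} (hq : Feasible p d D q) (sA : Finset A) (sB : Finset B)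
    (sC : Finset C) (hs : ∀ ω, q ω ≠ 0 → ω.1.1 ∈ sA ∧ ω.1.2.1 ∈ sB ∧ ω.1.2.2 ∈ sC)
    (hA : #sA ≤ Fintype.card A') (hB : #sB ≤ Fintype.card B') (hC : #sC ≤ Fintype.card C') :
    ∃ q' : (A' × B' × C') × S × U × V → ℝ, Feasible p d D q' ∧ commonRate q' = commonRate q ∧
      sumRateDdag q' = sumRateDdag q ∧ sumRateDag q' = sumRateDag q ∧
      (CondIndep q → CondIndep q') := by
  obtain ⟨ω₀, hω₀⟩ := hq.1.exists_ne_zero hp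
  obtain ⟨h0A, h0B, h0C⟩ := hs ω₀ hω₀
  obtain ⟨φA, ψA, hψA⟩ := CRR.exists_rename sA ⟨_, h0A⟩ hA
  obtain ⟨φB, ψB, hψB⟩ := CRR.exists_rename sB ⟨_, h0B⟩ hB
  obtain ⟨φC, ψC, hψC⟩ := CRR.exists_rename sC ⟨_, h0C⟩ hC
  have rA : ∀ ω, q ω ≠ 0 → ψA (φA ω.1.1) = ω.1.1 := fun ω hω => hψA _ (hs ω hω).1
  have rB : ∀ ω, q ω ≠ 0 → ψB (φB ω.1.2.1) = ω.1.2.1 := fun ω hω => hψB _ (hs ω hω).2.1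
  have rC : ∀ ω, q ω ≠ 0 → ψC (φC ω.1.2.2) = ω.1.2.2 := fun ω hω => hψC _ (hs ω hω).2.2
  have kA := SameKer.of_retract rA
  have kB := SameKer.of_retract rB
  have kC := SameKer.of_retract rC
  refine ⟨push q (fun ω => ((φA ω.1.1, φB ω.1.2.1, φC ω.1.2.2), ω.2)), ⟨?_, ?_⟩, ?_, ?_, ?_, ?_⟩
  · exact hq.1.map (fun a => (φA a.1, φB a.2.1, φC a.2.2))
  · exact hq.2.push _ _ _ _ (fun z => (ψA z.1, ψB z.2.1, z.2.2))
      (fun z => (ψA z.1, ψC z.2.1, z.2.2)) (fun ω hω => by simp only [rA ω hω, rB ω hω])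
      (fun ω hω => by simp only [rA ω hω, rC ω hω]) (fun _ => rfl)
  · unfold commonRate
    rw [condMI_push, condMI_congr (SameKer.refl _ _) (kA.prod kB) (SameKer.refl _ _)]
  · unfold sumRateDdag
    rw [condMI_push, condMI_push,
      condMI_congr (SameKer.refl _ _) kB (kA.prod (kC.prod (SameKer.refl _ _))),
      condMI_congr (SameKer.refl _ _) (kA.prod kC) (SameKer.refl _ _)]
  · unfold sumRateDag
    rw [condMI_push, condMI_push, condMI_push, condMI_push,
      condMI_congr (SameKer.refl _ _) kA (SameKer.refl _ (fun x => x.2.2.1)),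
      condMI_congr (SameKer.refl _ _) kA (SameKer.refl _ (fun x => x.2.2.2)),
      condMI_congr (SameKer.refl _ _) kB (kA.prod (SameKer.refl _ _)),
      condMI_congr (SameKer.refl _ _) kC (kA.prod (SameKer.refl _ _))]
  · intro h
    unfold CondIndep at h ⊢
    rw [markovChain_push]
    have h1 := h.comp_mid (fun z => (φA z.1, z.2)) (fun z => (ψA z.1, z.2))
      (fun ω hω => by simp only [rA ω hω])
    exact ((h1.comp_left (fun b _ => φB b)).symm.comp_left (fun c _ => φC c)).symm

/-- The variable `B` can be replaced by the reconstruction map `u ↦ ŝ` that it selects. -/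
theorem Feasible.exists_decoder_valued {p : S × U × V → ℝ} [Fintype W] {d : S → W → ℝ} {D : ℝ}
    {q : (A × B × C) × S × U × V → ℝ} (hq : Feasible p d D q) :
    ∃ q' : (A × (U → W) × C) × S × U × V → ℝ, Feasible p d D q' ∧
      commonRate q' ≤ commonRate q ∧ sumRateDdag q' ≤ sumRateDdag q ∧
      sumRateDag q' ≤ sumRateDag q ∧ (CondIndep q → CondIndep q') := by
  obtain ⟨hadm, h, h', hh, hD⟩ := hq
  have h0 := hadm.1
  refine ⟨push q (fun ω => ((ω.1.1, fun u => h' (ω.1.1, ω.1.2.1, u), ω.1.2.2), ω.2)),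
    ⟨hadm.map (fun a => (a.1, fun u => h' (a.1, a.2.1, u), a.2.2)),
      h, fun z => z.2.1 z.2.2, ?_, ?_⟩, ?_, ?_, ?_, ?_⟩
  · intro ω' hω'
    obtain ⟨ω, rfl, hω⟩ := exists_of_push_ne_zero hω'
    exact hh ω hω
  · rwa [expVal_push]
  · unfold commonRate
    rw [condMI_push]
    exact condMI_comp_le h0 (fun x => x.2.1) (fun x => (x.1.1, x.1.2.1)) (fun x => x.2.2.1)
      (fun a _ => (a.1, fun u => h' (a.1, a.2, u)))
  · unfold sumRateDdag
    rw [condMI_push, condMI_push]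
    exact add_le_add (condMI_comp_le h0 (fun x => x.2.1) (fun x => x.1.2.1)
      (fun x => (x.1.1, x.1.2.2, x.2.2)) (fun b z => fun u => h' (z.1, b, u))) le_rfl
  · unfold sumRateDag
    rw [condMI_push, condMI_push, condMI_push, condMI_push]
    exact add_le_add (add_le_add le_rfl (condMI_comp_le h0 (fun x => x.2.1) (fun x => x.1.2.1)
      (fun x => (x.1.1, x.2.2.1)) (fun b z => fun u => h' (z.1, b, u)))) le_rfl
  · intro hM
    unfold CondIndep
    rw [markovChain_push]
    exact hM.comp_left (fun b z => fun u => h' (z.1, b, u))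

theorem Feasible.exists_reweight_fst_ddag {p : S × U × V → ℝ} {d : S → W → ℝ} {D : ℝ}
    {q : (A × B × C) × S × U × V → ℝ} (hq : Feasible p d D q) :
    ∃ r : A → ℝ, #{a | r a ≠ 0} ≤ Fintype.card S + 2 ∧
      Feasible p d D (reweight r (fun x => x.1.1) q) ∧
      commonRate (reweight r (fun x => x.1.1) q) ≤ commonRate q ∧
      sumRateDdag (reweight r (fun x => x.1.1) q) ≤ sumRateDdag q := by
  obtain ⟨hadm, h, h', hh, hD⟩ := hq
  obtain ⟨r, hr, hcard, hlaw, hF, hc⟩ := exists_reweight hadm.1 (fun x => x.1.1)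
    (fun x => ((), x.2.1))
    ![partialInfo q (fun x => x.2.1) (fun x => (x.1.1, x.1.2.1)) (fun x => x.2.2.1),
      fun ω => infoDensity q (fun x => x.2.1) (fun x => x.1.2.1)
          (fun x => (x.1.1, x.1.2.2, x.2.2)) ω +
        partialInfo q (fun x => x.2.1) (fun x => (x.1.1, x.1.2.2)) (fun x => x.2.2.2) ω]
    (fun x => d x.2.1 (h (x.1.1, x.1.2.2, x.2.2.2)))
  have hlaw' := hadm.reweight_push (x := fun a => a.1) (y := fun _ => ()) hlaw
  have hadm' := hadm.reweight (x := fun a => a.1) (y := fun _ => ()) hr hlaw'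
  have e1 := condMI_reweight_sub hadm.1 r (fun x => x.1.1) (fun x => x.2.1)
    (fun x => (x.1.1, x.1.2.1)) (fun x => x.2.2.1) Prod.fst (fun _ => rfl)
    (push_comp_eq hlaw' fun z => (z.2.1, z.2.2.1))
  have e2 := condMI_reweight_sub hadm.1 r (fun x => x.1.1) (fun x => x.2.1)
    (fun x => (x.1.1, x.1.2.2)) (fun x => x.2.2.2) Prod.fst (fun _ => rfl)
    (push_comp_eq hlaw' fun z => (z.2.1, z.2.2.2))
  have e3 := condMI_reweight_of_cond hadm.1 r (fun x => x.1.1) (fun x => x.2.1)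
    (fun x => x.1.2.1) (fun x => (x.1.1, x.1.2.2, x.2.2)) Prod.fst (fun _ => rfl)
  have e4 := condMI_eq_expVal_infoDensity q (fun x => x.2.1)
    (fun x => x.1.2.1) (fun x => (x.1.1, x.1.2.2, x.2.2))
  have f1 := hF 0
  have f2 := hF 1
  simp only [Matrix.cons_val_zero, Matrix.cons_val_one, expVal_add] at f1 f2
  refine ⟨r, by simpa using hcard, ⟨hadm', h, h',
    fun ω hω => hh ω (ne_zero_of_reweight hω).2, hc.trans hD⟩, ?_, ?_⟩
  · unfold commonRate
    linarith
  · unfold sumRateDdag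
    linarith

theorem Feasible.exists_reweight_fst_dag {p : S × U × V → ℝ} {d : S → W → ℝ} {D : ℝ}
    {q : (A × B × C) × S × U × V → ℝ} (hq : Feasible p d D q) (hM : CondIndep q) :
    ∃ r : A → ℝ, #{a | r a ≠ 0} ≤ Fintype.card S + 3 ∧
      Feasible p d D (reweight r (fun x => x.1.1) q) ∧
      CondIndep (reweight r (fun x => x.1.1) q) ∧
      commonRate (reweight r (fun x => x.1.1) q) ≤ commonRate q ∧
      sumRateDag (reweight r (fun x => x.1.1) q) ≤ sumRateDag q := by
  obtain ⟨hadm, h, h', hh, hD⟩ := hq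
  obtain ⟨r, hr, hcard, hlaw, hF, hc⟩ := exists_reweight hadm.1 (fun x => x.1.1)
    (fun x => ((), x.2.1))
    ![partialInfo q (fun x => x.2.1) (fun x => (x.1.1, x.1.2.1)) (fun x => x.2.2.1),
      fun ω => partialInfo q (fun x => x.2.1) (fun x => x.1.1) (fun x => x.2.2.1) ω +
        infoDensity q (fun x => x.2.1) (fun x => x.1.2.1) (fun x => (x.1.1, x.2.2.1)) ω +
        infoDensity q (fun x => x.2.1) (fun x => x.1.2.2) (fun x => (x.1.1, x.2.2.2)) ω,
      fun ω => partialInfo q (fun x => x.2.1) (fun x => x.1.1) (fun x => x.2.2.2) ω +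
        infoDensity q (fun x => x.2.1) (fun x => x.1.2.1) (fun x => (x.1.1, x.2.2.1)) ω +
        infoDensity q (fun x => x.2.1) (fun x => x.1.2.2) (fun x => (x.1.1, x.2.2.2)) ω]
    (fun x => d x.2.1 (h (x.1.1, x.1.2.2, x.2.2.2)))
  have hlaw' := hadm.reweight_push (x := fun a => a.1) (y := fun _ => ()) hlaw
  have hadm' := hadm.reweight (x := fun a => a.1) (y := fun _ => ()) hr hlaw'
  have e1 := condMI_reweight_sub hadm.1 r (fun x => x.1.1) (fun x => x.2.1)
    (fun x => (x.1.1, x.1.2.1)) (fun x => x.2.2.1) Prod.fst (fun _ => rfl)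
    (push_comp_eq hlaw' fun z => (z.2.1, z.2.2.1))
  have e2 := condMI_reweight_sub hadm.1 r (fun x => x.1.1) (fun x => x.2.1)
    (fun x => x.1.1) (fun x => x.2.2.1) id (fun _ => rfl)
    (push_comp_eq hlaw' fun z => (z.2.1, z.2.2.1))
  have e3 := condMI_reweight_sub hadm.1 r (fun x => x.1.1) (fun x => x.2.1)
    (fun x => x.1.1) (fun x => x.2.2.2) id (fun _ => rfl)
    (push_comp_eq hlaw' fun z => (z.2.1, z.2.2.2))
  have e4 := condMI_reweight_of_cond hadm.1 r (fun x => x.1.1) (fun x => x.2.1)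
    (fun x => x.1.2.1) (fun x => (x.1.1, x.2.2.1)) Prod.fst (fun _ => rfl)
  have e5 := condMI_reweight_of_cond hadm.1 r (fun x => x.1.1) (fun x => x.2.1)
    (fun x => x.1.2.2) (fun x => (x.1.1, x.2.2.2)) Prod.fst (fun _ => rfl)
  have e6 := condMI_eq_expVal_infoDensity q (fun x => x.2.1)
    (fun x => x.1.2.1) (fun x => (x.1.1, x.2.2.1))
  have e7 := condMI_eq_expVal_infoDensity q (fun x => x.2.1)
    (fun x => x.1.2.2) (fun x => (x.1.1, x.2.2.2))
  have f1 := hF 0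
  have f2 := hF 1
  have f3 := hF 2
  simp only [Matrix.cons_val_zero, Matrix.cons_val_one, Matrix.cons_val, expVal_add] at f1 f2 f3
  refine ⟨r, by simpa using hcard, ⟨hadm', h, h',
    fun ω hω => hh ω (ne_zero_of_reweight hω).2, hc.trans hD⟩,
    MarkovChain.reweight_mid hM r Prod.fst, ?_, ?_⟩
  · unfold commonRate
    linarith
  · unfold sumRateDag
    rw [max_add, max_add, max_add, max_add]
    exact max_le_max (by linarith) (by linarith)

theorem Feasible.exists_reweight_snd_ddag {p : S × U × V → ℝ} {d : S → W → ℝ} {D : ℝ}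
    {q : (A × B × C) × S × U × V → ℝ} (hq : Feasible p d D q) :
    ∃ r : C → ℝ,
      #{c | r c ≠ 0} ≤ Fintype.card A * Fintype.card B * Fintype.card S + 1 ∧
      Feasible p d D (reweight r (fun x => x.1.2.2) q) ∧
      commonRate (reweight r (fun x => x.1.2.2) q) ≤ commonRate q ∧
      sumRateDdag (reweight r (fun x => x.1.2.2) q) ≤ sumRateDdag q := by
  obtain ⟨hadm, h, h', hh, hD⟩ := hq
  obtain ⟨r, hr, hcard, hlaw, hF, hc⟩ := exists_reweight hadm.1 (fun x => x.1.2.2)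
    (fun x => ((x.1.1, x.1.2.1), x.2.1))
    (fun _ : Unit => fun ω => infoDensity q (fun x => x.2.1) (fun x => x.1.2.1)
          (fun x => (x.1.1, x.1.2.2, x.2.2)) ω +
        partialInfo q (fun x => x.2.1) (fun x => (x.1.1, x.1.2.2)) (fun x => x.2.2.2) ω)
    (fun x => d x.2.1 (h (x.1.1, x.1.2.2, x.2.2.2)))
  have hlaw' := hadm.reweight_push (x := fun a => a.2.2) (y := fun a => (a.1, a.2.1)) hlaw
  have hadm' := hadm.reweight (x := fun a => a.2.2) (y := fun a => (a.1, a.2.1)) hr hlaw'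
  have e1 : commonRate (reweight r (fun x => x.1.2.2) q) = commonRate q :=
    condMI_comp_eq hlaw' (fun z => z.2.1) (fun z => z.1) (fun z => z.2.2.1)
  have e2 := condMI_reweight_sub hadm.1 r (fun x => x.1.2.2) (fun x => x.2.1)
    (fun x => (x.1.1, x.1.2.2)) (fun x => x.2.2.2) Prod.snd (fun _ => rfl)
    (push_comp_eq hlaw' fun z => (z.2.1, z.2.2.2))
  have e3 := condMI_reweight_of_cond hadm.1 r (fun x => x.1.2.2) (fun x => x.2.1)
    (fun x => x.1.2.1) (fun x => (x.1.1, x.1.2.2, x.2.2)) (fun z => z.2.1) (fun _ => rfl)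
  have e4 := condMI_eq_expVal_infoDensity q (fun x => x.2.1)
    (fun x => x.1.2.1) (fun x => (x.1.1, x.1.2.2, x.2.2))
  have f1 := hF ()
  simp only [expVal_add] at f1
  refine ⟨r, by simpa using hcard, ⟨hadm', h, h',
    fun ω hω => hh ω (ne_zero_of_reweight hω).2, hc.trans hD⟩, e1.le, ?_⟩
  unfold sumRateDdag
  linarith

theorem Feasible.exists_reweight_snd_dag {p : S × U × V → ℝ} {d : S → W → ℝ} {D : ℝ}
    {q : (A × B × C) × S × U × V → ℝ} (hq : Feasible p d D q) (hM : CondIndep q) :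
    ∃ r : C → ℝ,
      #{c | r c ≠ 0} ≤ Fintype.card A * Fintype.card B * Fintype.card S + 1 ∧
      Feasible p d D (reweight r (fun x => x.1.2.2) q) ∧
      CondIndep (reweight r (fun x => x.1.2.2) q) ∧
      commonRate (reweight r (fun x => x.1.2.2) q) ≤ commonRate q ∧
      sumRateDag (reweight r (fun x => x.1.2.2) q) ≤ sumRateDag q := by
  obtain ⟨hadm, h, h', hh, hD⟩ := hq
  obtain ⟨r, hr, hcard, hlaw, hF, hc⟩ := exists_reweight hadm.1 (fun x => x.1.2.2)
    (fun x => ((x.1.1, x.1.2.1), x.2.1))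
    (fun _ : Unit => partialInfo q (fun x => x.2.1) (fun x => x.1.2.2)
      (fun x => (x.1.1, x.2.2.2)))
    (fun x => d x.2.1 (h (x.1.1, x.1.2.2, x.2.2.2)))
  have hlaw' := hadm.reweight_push (x := fun a => a.2.2) (y := fun a => (a.1, a.2.1)) hlaw
  have hadm' := hadm.reweight (x := fun a => a.2.2) (y := fun a => (a.1, a.2.1)) hr hlaw'
  have e1 : commonRate (reweight r (fun x => x.1.2.2) q) = commonRate q :=
    condMI_comp_eq hlaw' (fun z => z.2.1) (fun z => z.1) (fun z => z.2.2.1)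
  have e2 := condMI_comp_eq hlaw' (fun z => z.2.1) (fun z => z.1.1) (fun z => z.2.2.1)
  have e3 := condMI_comp_eq hlaw' (fun z => z.2.1) (fun z => z.1.1) (fun z => z.2.2.2)
  have e4 := condMI_comp_eq hlaw' (fun z => z.2.1) (fun z => z.1.2) (fun z => (z.1.1, z.2.2.1))
  have e5 := condMI_reweight_sub hadm.1 r (fun x => x.1.2.2) (fun x => x.2.1)
    (fun x => x.1.2.2) (fun x => (x.1.1, x.2.2.2)) id (fun _ => rfl)
    (push_comp_eq hlaw' fun z => (z.2.1, z.1.1, z.2.2.2))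
  have f1 := hF ()
  refine ⟨r, by simpa using hcard, ⟨hadm', h, h',
    fun ω hω => hh ω (ne_zero_of_reweight hω).2, hc.trans hD⟩,
    MarkovChain.reweight_right hM r (push_comp_eq hlaw' fun z => (z.1.2, z.1.1, z.2.1)),
    e1.le, ?_⟩
  unfold sumRateDag
  rw [e2, e3, e4]
  linarith

variable [Fintype W]

theorem RDdag_subset {p : S × U × V → ℝ} (hp : IsPMF p) (d : S → W → ℝ) (D : ℝ) (k : ℕ) :
    RDdag p d D k ⊆ RDdag p d D
      (Fintype.card S * (Fintype.card S + 6) * Fintype.card W ^ Fintype.card U + 4) := by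
  rintro r₀ ⟨hr1, hr2, q, hq, hR1, hR2⟩
  rw [PDdag_iff_feasible hp] at hq
  obtain ⟨q₁, hq₁, a₁, b₁, -, -⟩ := hq.exists_decoder_valued
  obtain ⟨r, hr, hq₂, a₂, b₂⟩ := hq₁.exists_reweight_fst_ddag
  obtain ⟨q₃, hq₃, a₃, b₃, -, -⟩ := hq₂.exists_rename (A' := Fin (Fintype.card S + 2))
    (B' := U → W) (C' := Fin k) hp {a | r a ≠ 0} univ univ
    (fun ω hω => by simpa using (ne_zero_of_reweight hω).1) (by simpa using hr) le_rfl le_rfl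
  obtain ⟨r', hr', hq₄, a₄, b₄⟩ := hq₃.exists_reweight_snd_ddag
  obtain ⟨ω, -⟩ := hq₄.1.exists_ne_zero hp
  have hS : 0 < Fintype.card S := Fintype.card_pos_iff.2 ⟨ω.2.1⟩
  have hW : 0 < Fintype.card (U → W) := Fintype.card_pos_iff.2 ⟨ω.1.2.1⟩
  rw [Fintype.card_fun] at hW
  simp only [Fintype.card_fin, Fintype.card_fun] at hr'
  set s := Fintype.card S
  set w := Fintype.card W ^ Fintype.card U
  have hsw : s ≤ s * w := Nat.le_mul_of_pos_right s hW
  have hws : w ≤ s * w := Nat.le_mul_of_pos_left w hS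
  have hssw : s * w ≤ s * (s * w) := Nat.le_mul_of_pos_left _ hS
  obtain ⟨q₅, hq₅, a₅, b₅, -, -⟩ := hq₄.exists_rename (A' := Fin (s * (s + 6) * w + 4))
    (B' := Fin (s * (s + 6) * w + 4)) (C' := Fin (s * (s + 6) * w + 4)) hp univ univ
    {c | r' c ≠ 0}
    (fun ω hω => by simpa using (ne_zero_of_reweight hω).1)
    (by rw [Finset.card_univ, Fintype.card_fin, Fintype.card_fin]; nlinarith)
    (by rw [Finset.card_univ, Fintype.card_fun, Fintype.card_fin]; change w ≤ _; nlinarith)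
    (by rw [Fintype.card_fin]; nlinarith)
  refine ⟨hr1, hr2, q₅, (PDdag_iff_feasible hp d D _ q₅).2 hq₅, ?_, ?_⟩
  · change commonRate q₅ ≤ _
    change commonRate q ≤ _ at hR1
    linarith
  · change sumRateDdag q₅ ≤ _
    change sumRateDdag q ≤ _ at hR2
    linarith

theorem RDag_subset {p : S × U × V → ℝ} (hp : IsPMF p) (d : S → W → ℝ) (D : ℝ) (k : ℕ) :
    RDag p d D k ⊆ RDag p d D
      (Fintype.card S * (Fintype.card S + 4) * Fintype.card W ^ Fintype.card U + 1) := by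
  rintro r₀ ⟨hr1, hr2, q, ⟨hq, hM⟩, hR1, hR2⟩
  rw [PDdag_iff_feasible hp] at hq
  obtain ⟨q₁, hq₁, a₁, -, b₁, m₁⟩ := hq.exists_decoder_valued
  obtain ⟨r, hr, hq₂, m₂, a₂, b₂⟩ := hq₁.exists_reweight_fst_dag (m₁ hM)
  obtain ⟨q₃, hq₃, a₃, -, b₃, m₃⟩ := hq₂.exists_rename (A' := Fin (Fintype.card S + 3))
    (B' := U → W) (C' := Fin k) hp {a | r a ≠ 0} univ univ
    (fun ω hω => by simpa using (ne_zero_of_reweight hω).1) (by simpa using hr) le_rfl le_rfl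
  obtain ⟨r', hr', hq₄, m₄, a₄, b₄⟩ := hq₃.exists_reweight_snd_dag (m₃ m₂)
  obtain ⟨ω, -⟩ := hq₄.1.exists_ne_zero hp
  have hS : 0 < Fintype.card S := Fintype.card_pos_iff.2 ⟨ω.2.1⟩
  have hW : 0 < Fintype.card (U → W) := Fintype.card_pos_iff.2 ⟨ω.1.2.1⟩
  rw [Fintype.card_fun] at hW
  simp only [Fintype.card_fin, Fintype.card_fun] at hr'
  set s := Fintype.card S
  set w := Fintype.card W ^ Fintype.card U
  have hsw : s ≤ s * w := Nat.le_mul_of_pos_right s hW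
  have hws : w ≤ s * w := Nat.le_mul_of_pos_left w hS
  have hssw : s * w ≤ s * (s * w) := Nat.le_mul_of_pos_left _ hS
  obtain ⟨q₅, hq₅, a₅, -, b₅, m₅⟩ := hq₄.exists_rename (A' := Fin (s * (s + 4) * w + 1))
    (B' := Fin (s * (s + 4) * w + 1)) (C' := Fin (s * (s + 4) * w + 1)) hp univ univ
    {c | r' c ≠ 0}
    (fun ω hω => by simpa using (ne_zero_of_reweight hω).1)
    (by rw [Finset.card_univ, Fintype.card_fin, Fintype.card_fin]; nlinarith)
    (by rw [Finset.card_univ, Fintype.card_fun, Fintype.card_fin]; change w ≤ _; nlinarith)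
    (by rw [Fintype.card_fin]; nlinarith)
  refine ⟨hr1, hr2, q₅, ⟨(PDdag_iff_feasible hp d D _ q₅).2 hq₅, m₅ m₄⟩, ?_, ?_⟩
  · change commonRate q₅ ≤ _
    change commonRate q ≤ _ at hR1
    linarith
  · change sumRateDag q₅ ≤ _
    change sumRateDag q ≤ _ at hR2
    linarith

end TripleAuxiliary

/-- Lemma 6: alphabet-size bounds for the three regions, and the
corresponding saturation of the unions ℛ*(D), ℛ‡(D), ℛ†(D). -/
theorem stmt6 {S U V W : Type*} [Fintype S] [Fintype U] [Fintype V] [Fintype W]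
    (p : S × U × V → ℝ) (hp : IsPMF p) (Dbar : ℝ) (hDbar : 0 < Dbar)
    (d : S → W → ℝ) (hd : ∀ s w, 0 ≤ d s w ∧ d s w ≤ Dbar)
    (D : ℝ) (hD : 0 ≤ D) :
    (∀ k : ℕ, RStar p d D k ⊆ RStar p d D (Fintype.card S + 2)) ∧
    (∀ k : ℕ, RDdag p d D k ⊆
      RDdag p d D
        (Fintype.card S * (Fintype.card S + 6) * Fintype.card W ^ Fintype.card U + 4)) ∧
    (∀ k : ℕ, RDag p d D k ⊆
      RDag p d D
        (Fintype.card S * (Fintype.card S + 4) * Fintype.card W ^ Fintype.card U + 1)) ∧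
    (⋃ k : ℕ, RStar p d D k) = RStar p d D (Fintype.card S + 2) ∧
    (⋃ k : ℕ, RDdag p d D k) =
      RDdag p d D
        (Fintype.card S * (Fintype.card S + 6) * Fintype.card W ^ Fintype.card U + 4) ∧
    (⋃ k : ℕ, RDag p d D k) =
      RDag p d D
        (Fintype.card S * (Fintype.card S + 4) * Fintype.card W ^ Fintype.card U + 1) := by
  have hu : ∀ (R : ℕ → Set (ℝ × ℝ)) (n : ℕ), (∀ k, R k ⊆ R n) → ⋃ k, R k = R n := fun R n h =>
    Set.Subset.antisymm (Set.iUnion_subset h) (Set.subset_iUnion R n)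
  exact ⟨RStar_subset hp d D, RDdag_subset hp d D, RDag_subset hp d D,
    hu _ _ (RStar_subset hp d D), hu _ _ (RDdag_subset hp d D), hu _ _ (RDag_subset hp d D)⟩

end CRR
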